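/- arXiv:1903.02936 — 2 statements merged into one kernel-verified Lean document; each statement's English description precedes it below -/
import Mathlib

section
/- (Zhang's characterization of the Hida test function space, coefficient form.) Let c : 𝒥 → ℝ be a family of real coefficients. Then the following are equivalent: (i) for every k ∈ ℕ, Σ_{α ∈ 𝒥} α!·c_α²·(2ℕ)^{kα} < ∞; (ii) for every k ∈ ℕ, sup_{α ∈ 𝒥} α!·c_α²·(2ℕ)^{kα} < ∞. -/
open MeasureTheory

noncomputable section

/-- The set `𝒥` of multi-indices: finitely supported functions from `{1,2,…}` (here indexed
by `ℕ`, index `j` standing for `j+1`) to the nonnegative integers. -/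
abbrev MultiIndex := ℕ →₀ ℕ

/-- `α! = Π_j α_j!` for a multi-index `α`. -/
def mfact (α : MultiIndex) : ℝ :=
  α.prod fun _ n => (Nat.factorial n : ℝ)

/-- `(2ℕ)^{qα} = Π_j (2j)^{q α_j}` for a real exponent `q` and a multi-index `α`
(index `j : ℕ` of the finsupp stands for the integer `j + 1`). -/
def twoNpow (q : ℝ) (α : MultiIndex) : ℝ :=
  α.prod fun j n => ((2 * (j + 1) : ℕ) : ℝ) ^ (q * (n : ℝ))

/-- The sum of `x ^ α` over all multi-indices converges, as `∏ i, (1 - x i)⁻¹` does. -/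
theorem summable_finsupp_prod_pow {ι : Type*} {x : ι → ℝ} (hx0 : ∀ i, 0 ≤ x i)
    (hx2 : ∀ i, x i ≤ 1 / 2) (hx : Summable x) :
    Summable fun α : ι →₀ ℕ => α.prod fun i n => x i ^ n := by
  classical
  have hnonneg (α : ι →₀ ℕ) : 0 ≤ α.prod fun i n => x i ^ n :=
    Finset.prod_nonneg fun i _ => pow_nonneg (hx0 i) _
  refine summable_of_sum_le (c := Real.exp (2 * ∑' i, x i)) hnonneg fun S => ?_
  set T : Finset ι := S.sup Finsupp.support with hT
  set t : ι → Finset ℕ := fun i => S.image fun α => α i with ht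
  have hsub : S ⊆ T.finsupp t := fun α hα => by
    rw [Finset.mem_finsupp_iff]
    exact ⟨Finset.le_sup (f := Finsupp.support) hα,
      fun i _ => Finset.mem_image_of_mem (fun β : ι →₀ ℕ => β i) hα⟩
  have hfactor (i : ι) : ∑ n ∈ t i, x i ^ n ≤ Real.exp (2 * x i) := by
    have hlt : x i < 1 := (hx2 i).trans_lt (by norm_num)
    calc ∑ n ∈ t i, x i ^ n ≤ ∑' n, x i ^ n :=
          (summable_geometric_of_lt_one (hx0 i) hlt).sum_le_tsum _
            fun n _ => pow_nonneg (hx0 i) n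
      _ = (1 - x i)⁻¹ := tsum_geometric_of_lt_one (hx0 i) hlt
      _ ≤ 2 * x i + 1 := by
          rw [inv_le_iff_one_le_mul₀ (by linarith)]
          nlinarith [hx0 i, hx2 i]
      _ ≤ Real.exp (2 * x i) := Real.add_one_le_exp _
  calc ∑ α ∈ S, α.prod (fun i n => x i ^ n)
      ≤ ∑ α ∈ T.finsupp t, α.prod (fun i n => x i ^ n) :=
        Finset.sum_le_sum_of_subset_of_nonneg hsub fun α _ _ => hnonneg α
    _ = ∑ α ∈ T.finsupp t, ∏ i ∈ T, x i ^ α i := Finset.sum_congr rfl fun α hα =>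
        Finsupp.prod_of_support_subset _ (Finset.mem_finsupp_iff.1 hα).1 _
          fun i _ => pow_zero _
    _ = ∏ i ∈ T, ∑ n ∈ t i, x i ^ n := by
        rw [Finset.prod_sum, Finset.finsupp, Finset.sum_map]
        refine Finset.sum_congr rfl fun p _ => ?_
        rw [← Finset.prod_attach]
        refine Finset.prod_congr rfl fun i _ => ?_
        simp [Finsupp.indicator_apply]
    _ ≤ ∏ i ∈ T, Real.exp (2 * x i) := Finset.prod_le_prod
        (fun i _ => Finset.sum_nonneg fun n _ => pow_nonneg (hx0 i) n) fun i _ => hfactor i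
    _ = Real.exp (2 * ∑ i ∈ T, x i) := by rw [← Real.exp_sum, Finset.mul_sum]
    _ ≤ Real.exp (2 * ∑' i, x i) := by
        gcongr
        exact hx.sum_le_tsum _ fun i _ => hx0 i

theorem mfact_nonneg (α : MultiIndex) : 0 ≤ mfact α :=
  Finset.prod_nonneg fun _ _ => Nat.cast_nonneg _

theorem twoNpow_nonneg (q : ℝ) (α : MultiIndex) : 0 ≤ twoNpow q α :=
  Finset.prod_nonneg fun _ _ => Real.rpow_nonneg (Nat.cast_nonneg _) _

theorem twoNpow_add (p q : ℝ) (α : MultiIndex) :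
    twoNpow (p + q) α = twoNpow p α * twoNpow q α := by
  unfold twoNpow
  rw [← Finsupp.prod_mul]
  refine Finset.prod_congr rfl fun j _ => ?_
  beta_reduce
  rw [add_mul, Real.rpow_add (by positivity)]

/-- The family `(2ℕ)^{-2α}` is summable. -/
theorem summable_twoNpow_neg_two : Summable (twoNpow (-2)) := by
  have hx : Summable fun j : ℕ => (((2 * (j + 1) : ℕ) : ℝ) ^ 2)⁻¹ := by
    have h := ((summable_nat_add_iff 1).2
      (Real.summable_nat_pow_inv.2 (by norm_num : 1 < 2))).mul_left (4⁻¹ : ℝ)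
    refine h.congr fun j => ?_
    push_cast
    rw [← mul_inv]
    ring
  refine (summable_finsupp_prod_pow (fun j => by positivity) (fun j => ?_) hx).congr fun α => ?_
  · rw [one_div]
    apply inv_anti₀ (by norm_num)
    push_cast
    nlinarith [(Nat.cast_nonneg j : (0 : ℝ) ≤ j)]
  · refine Finset.prod_congr rfl fun j _ => ?_
    beta_reduce
    rw [Real.rpow_mul (by positivity), Real.rpow_natCast, Real.rpow_neg (by positivity),
      Real.rpow_two]

/-- **Zhang's characterization of the Hida test function space** (coefficient form):
`Σ_α α! c_α² (2ℕ)^{kα} < ∞` for every `k ∈ ℕ` if and only if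
`sup_α α! c_α² (2ℕ)^{kα} < ∞` for every `k ∈ ℕ`. -/
theorem zhang_test_function_characterization (c : MultiIndex → ℝ) :
    (∀ k : ℕ, Summable (fun α : MultiIndex => mfact α * (c α)^2 * twoNpow (k : ℝ) α)) ↔
    (∀ k : ℕ, ∃ M : ℝ, ∀ α : MultiIndex, mfact α * (c α)^2 * twoNpow (k : ℝ) α ≤ M) := by
  have hnonneg (k : ℕ) (α : MultiIndex) : 0 ≤ mfact α * (c α)^2 * twoNpow (k : ℝ) α :=
    mul_nonneg (mul_nonneg (mfact_nonneg α) (sq_nonneg _)) (twoNpow_nonneg _ α)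
  refine ⟨fun h k => ⟨_, fun α => (h k).le_tsum α fun β _ => hnonneg k β⟩, fun h k => ?_⟩
  obtain ⟨M, hM⟩ := h (k + 2)
  refine (summable_twoNpow_neg_two.mul_left M).of_nonneg_of_le (hnonneg k) fun α => ?_
  have hk : (k : ℝ) = ((k + 2 : ℕ) : ℝ) + -2 := by push_cast; ring
  rw [hk, twoNpow_add, ← mul_assoc]
  exact mul_le_mul_of_nonneg_right (hM α) (twoNpow_nonneg _ α)

end
end

section
/- There exists a constant C > 0 such that for every k ≥ 1 and every x ∈ ℝ, |e_k(x)| ≤ C·k^{−1/12}; that is, sup_{x ∈ ℝ} |e_k(x)| = O(k^{−1/12}) as k → ∞. -/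
open MeasureTheory

noncomputable section

/-- The `n`-th probabilists' Hermite polynomial
`hₙ(x) = (−1)ⁿ e^{x²/2} (dⁿ/dxⁿ) e^{−x²/2}`. -/
def hermiteP (n : ℕ) (x : ℝ) : ℝ :=
  (-1 : ℝ)^n * Real.exp (x^2 / 2) * iteratedDeriv n (fun y => Real.exp (-(y^2) / 2)) x

/-- The `k`-th Hermite function (`k ≥ 1`):
`e_k(x) = π^{−1/4} ((k−1)!)^{−1/2} e^{−x²/2} h_{k−1}(√2 x)`. -/
def hermiteFun (k : ℕ) (x : ℝ) : ℝ :=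
  Real.pi ^ (-(1/4) : ℝ) * ((Nat.factorial (k - 1) : ℝ)) ^ (-(1/2) : ℝ) *
    Real.exp (-(x^2) / 2) * hermiteP (k - 1) (Real.sqrt 2 * x)

open Filter Topology

theorem monotoneOn_of_hasDerivAt_nonneg {D : Set ℝ} (hD : Convex ℝ D) {f f' : ℝ → ℝ}
    (hf : ∀ x ∈ D, HasDerivAt f (f' x) x) (hf' : ∀ x ∈ D, 0 ≤ f' x) : MonotoneOn f D :=
  monotoneOn_of_hasDerivWithinAt_nonneg hD
    (fun x hx => (hf x hx).continuousAt.continuousWithinAt)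
    (fun x hx => (hf x (interior_subset hx)).hasDerivWithinAt)
    (fun x hx => hf' x (interior_subset hx))

theorem antitoneOn_of_hasDerivAt_nonpos {D : Set ℝ} (hD : Convex ℝ D) {f f' : ℝ → ℝ}
    (hf : ∀ x ∈ D, HasDerivAt f (f' x) x) (hf' : ∀ x ∈ D, f' x ≤ 0) : AntitoneOn f D :=
  antitoneOn_of_hasDerivWithinAt_nonpos hD
    (fun x hx => (hf x hx).continuousAt.continuousWithinAt)
    (fun x hx => (hf x (interior_subset hx)).hasDerivWithinAt)
    (fun x hx => hf' x (interior_subset hx))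

/-- The energy `(L - x²) u² + u'²` of a solution of `u'' = (x² - L) u` decreases on `[0, ∞)`. -/
theorem antitoneOn_energy {L : ℝ} {u v : ℝ → ℝ} (hu : ∀ x, HasDerivAt u (v x) x)
    (hv : ∀ x, HasDerivAt v ((x ^ 2 - L) * u x) x) :
    AntitoneOn (fun x => (L - x ^ 2) * u x ^ 2 + v x ^ 2) (Set.Ici 0) := by
  refine antitoneOn_of_hasDerivAt_nonpos (convex_Ici 0) (f' := fun x => -(2 * x * u x ^ 2))
    (fun x _ => ?_) (fun x hx => ?_)
  · have hq : HasDerivAt (fun y : ℝ => L - y ^ 2) (-(2 * x)) x := by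
      simpa using (hasDerivAt_pow 2 x).const_sub L
    refine ((hq.mul ((hu x).pow 2)).add ((hv x).pow 2)).congr_deriv ?_
    simp only [Pi.pow_apply]
    push_cast
    ring
  · have hx : 0 ≤ x := hx
    have : 0 ≤ 2 * x * u x ^ 2 := by positivity
    simpa using this

/-- Liouville–Green bound for solutions of `u'' = (x² - L) u` left of the turning point: the
energy of the Liouville-transformed solution grows at most by the factor
`exp (5 x / (4 (L - x²)^{3/2}))`. -/
theorem liouvilleGreen_energy_le {L : ℝ} {u v : ℝ → ℝ} (hu : ∀ x, HasDerivAt u (v x) x)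
    (hv : ∀ x, HasDerivAt v ((x ^ 2 - L) * u x) x) {b : ℝ} (hb : 0 ≤ b) (hbL : 0 < L - b ^ 2) :
    √(L - b ^ 2) * u b ^ 2 + (v b - b * u b / (2 * (L - b ^ 2))) ^ 2 / √(L - b ^ 2) ≤
      (√L * u 0 ^ 2 + v 0 ^ 2 / √L) * Real.exp (5 / 4 * (b / √(L - b ^ 2) ^ 3)) := by
  set s : ℝ → ℝ := fun x => √(L - x ^ 2) with hs
  set w : ℝ → ℝ := fun x => v x - x * u x / (2 * (L - x ^ 2)) with hw
  set G : ℝ → ℝ := fun x => s x * u x ^ 2 + w x ^ 2 / s x with hG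
  set Φ : ℝ → ℝ := fun x => 5 / 4 * (x / s x ^ 3) with hΦ
  have hpos : ∀ x ∈ Set.Icc 0 b, 0 < L - x ^ 2 := by
    rintro x ⟨h0, h1⟩
    nlinarith
  have hs0 : ∀ x ∈ Set.Icc 0 b, 0 < s x := fun x hx => Real.sqrt_pos.2 (hpos x hx)
  have hsq : ∀ x ∈ Set.Icc 0 b, L - x ^ 2 = s x ^ 2 :=
    fun x hx => (Real.sq_sqrt (hpos x hx).le).symm
  have hq : ∀ x, HasDerivAt (fun y : ℝ => L - y ^ 2) (-(2 * x)) x := fun x => by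
    simpa using (hasDerivAt_pow 2 x).const_sub L
  have hs' : ∀ x ∈ Set.Icc 0 b, HasDerivAt s (-x / s x) x := fun x hx => by
    refine ((hq x).sqrt (hpos x hx).ne').congr_deriv ?_
    have := hs0 x hx
    change -(2 * x) / (2 * s x) = _
    field_simp
  have hw' : ∀ x ∈ Set.Icc 0 b, HasDerivAt w
      (-(s x ^ 2) * u x - (u x + x * v x) / (2 * s x ^ 2) - x ^ 2 * u x / s x ^ 4) x := by
    intro x hx
    refine ((hv x).sub ((((hasDerivAt_id x).mul (hu x))).div ((hq x).const_mul 2)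
      (mul_pos two_pos (hpos x hx)).ne')).congr_deriv ?_
    have h1 := hs0 x hx
    have h2 := hsq x hx
    simp only [id, Pi.mul_apply, h2]
    rw [show x ^ 2 - L = -(s x ^ 2) by linarith]
    field_simp
    ring
  have hG' : ∀ x ∈ Set.Icc 0 b, HasDerivAt G
      (-(2 * (1 / (2 * s x ^ 3) + 5 * x ^ 2 / (4 * s x ^ 5)) * (u x * w x))) x := by
    intro x hx
    have h1 := hs0 x hx
    refine (((hs' x hx).mul ((hu x).pow 2)).add
      (((hw' x hx).pow 2).div (hs' x hx) h1.ne')).congr_deriv ?_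
    have h3 : v x = w x + x * u x / (2 * s x ^ 2) := by
      simp only [hw, hsq x hx]
      ring
    simp only [Pi.pow_apply, h3]
    push_cast
    field_simp
    ring
  have hΦ' : ∀ x ∈ Set.Icc 0 b, HasDerivAt Φ (5 / 4 * ((s x ^ 2 + 3 * x ^ 2) / s x ^ 5)) x := by
    intro x hx
    have h1 := hs0 x hx
    refine ((((hasDerivAt_id x).div ((hs' x hx).pow 3) (pow_pos h1 3).ne').const_mul
      (5 / 4 : ℝ))).congr_deriv ?_
    simp only [id, Pi.pow_apply]
    push_cast
    field_simp
    ring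
  have hanti : AntitoneOn (fun x => G x * Real.exp (-Φ x)) (Set.Icc 0 b) := by
    refine antitoneOn_of_hasDerivAt_nonpos (convex_Icc 0 b)
      (fun x hx => (hG' x hx).mul (hΦ' x hx).neg.exp) fun x hx => ?_
    have h1 := hs0 x hx
    set K := 1 / (2 * s x ^ 3) + 5 * x ^ 2 / (4 * s x ^ 5) with hK
    set P := 5 / 4 * ((s x ^ 2 + 3 * x ^ 2) / s x ^ 5) with hP
    have hK0 : 0 ≤ K := by positivity
    have hKP : K ≤ P := by
      have : P - K = (3 * s x ^ 2 + 10 * x ^ 2) / (4 * s x ^ 5) := by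
        rw [hK, hP]
        field_simp
        ring
      have : 0 ≤ P - K := this ▸ by positivity
      linarith
    have hG0 : 0 ≤ G x := by simp only [hG]; positivity
    have huw : -(2 * (u x * w x)) ≤ G x := by
      have : G x + 2 * (u x * w x) = (s x * u x + w x) ^ 2 / s x := by
        simp only [hG]
        field_simp
        ring
      have : 0 ≤ G x + 2 * (u x * w x) := this ▸ by positivity
      linarith
    have hle : -(2 * K * (u x * w x)) ≤ G x * P := by
      nlinarith [mul_le_mul_of_nonneg_left huw hK0, mul_le_mul_of_nonneg_left hKP hG0]
    have hle' := mul_le_mul_of_nonneg_right hle (Real.exp_pos (-Φ x)).le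
    simp only [Pi.neg_apply]
    linarith
  have h := hanti (Set.left_mem_Icc.2 hb) (Set.right_mem_Icc.2 hb) hb
  have h00 : G 0 * Real.exp (-Φ 0) = √L * u 0 ^ 2 + v 0 ^ 2 / √L := by
    simp [hG, hΦ, hw, hs]
  simp only [h00] at h
  calc G b = G b * Real.exp (-Φ b) * Real.exp (Φ b) := by
        rw [mul_assoc, ← Real.exp_add]; simp
    _ ≤ _ := mul_le_mul_of_nonneg_right h (Real.exp_pos _).le

/-- A solution of `u'' = (x² - L) u` which tends to zero at infinity decreases in absolute value
to the right of the turning point. -/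
theorem antitoneOn_sq_of_tendsto_zero {L c : ℝ} {u v : ℝ → ℝ} (hu : ∀ x, HasDerivAt u (v x) x)
    (hv : ∀ x, HasDerivAt v ((x ^ 2 - L) * u x) x) (hlim : Tendsto u atTop (𝓝 0))
    (hc : ∀ x ∈ Set.Ici c, L ≤ x ^ 2) : AntitoneOn (fun x => u x ^ 2) (Set.Ici c) := by
  have hsq' : ∀ x, HasDerivAt (fun y => u y ^ 2) (2 * (u x * v x)) x := fun x => by
    refine ((hu x).pow 2).congr_deriv ?_
    push_cast
    ring
  have hmono : MonotoneOn (fun x => u x * v x) (Set.Ici c) := by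
    refine monotoneOn_of_hasDerivAt_nonneg (convex_Ici c)
      (fun x _ => (hu x).mul (hv x)) fun x hx => ?_
    nlinarith [mul_nonneg (sub_nonneg.2 (hc x hx)) (sq_nonneg (u x)), sq_nonneg (v x)]
  have hnonpos : ∀ x ∈ Set.Ici c, u x * v x ≤ 0 := by
    intro x hx
    by_contra! hlt
    have hm : MonotoneOn (fun y => u y ^ 2) (Set.Ici x) :=
      monotoneOn_of_hasDerivAt_nonneg (convex_Ici x) (fun y _ => hsq' y) fun y hy => by
        have : u x * v x ≤ u y * v y := hmono hx (Set.mem_Ici.2 (hx.out.trans hy.out)) hy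
        linarith
    have h0 : u x ^ 2 ≤ 0 := by
      have hl : Tendsto (fun y => u y ^ 2) atTop (𝓝 0) := by simpa using hlim.pow 2
      exact ge_of_tendsto hl ((eventually_ge_atTop x).mono fun y hy => hm Set.self_mem_Ici hy hy)
    have : u x = 0 := by nlinarith
    simp [this] at hlt
  exact antitoneOn_of_hasDerivAt_nonpos (convex_Ici c) (fun x _ => hsq' x)
    fun x hx => by linarith [hnonpos x hx]

/-- Liouville–Green bound up to the point where `a⁶ - x² = a²`, in terms of the energy at `0`. -/
theorem liouvilleGreen_energy_le_of_energy_le {a M : ℝ} (ha : 0 < a) {u v : ℝ → ℝ}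
    (hu : ∀ x, HasDerivAt u (v x) x) (hv : ∀ x, HasDerivAt v ((x ^ 2 - a ^ 6) * u x) x)
    (h0 : a ^ 6 * u 0 ^ 2 + v 0 ^ 2 ≤ M * a ^ 3) {y : ℝ} (hy : 0 ≤ y)
    (hya : a ^ 2 ≤ a ^ 6 - y ^ 2) :
    √(a ^ 6 - y ^ 2) * u y ^ 2 +
      (v y - y * u y / (2 * (a ^ 6 - y ^ 2))) ^ 2 / √(a ^ 6 - y ^ 2) ≤ M * Real.exp (5 / 4) := by
  have hM : 0 ≤ M :=
    nonneg_of_mul_nonneg_left (le_trans (by positivity) h0) (by positivity : 0 < a ^ 3)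
  have hsqrt : √(a ^ 6) = a ^ 3 := by
    rw [show a ^ 6 = (a ^ 3) ^ 2 by ring, Real.sqrt_sq (by positivity)]
  have hs : a ≤ √(a ^ 6 - y ^ 2) := Real.le_sqrt_of_sq_le hya
  have hs0 : 0 < √(a ^ 6 - y ^ 2) := ha.trans_le hs
  have hy3 : y ≤ a ^ 3 := by
    refine le_of_sq_le_sq ?_ (by positivity)
    nlinarith [sq_nonneg a]
  refine (liouvilleGreen_energy_le hu hv hy (lt_of_lt_of_le (by positivity) hya)).trans ?_
  rw [hsqrt]
  refine mul_le_mul ?_ (Real.exp_le_exp.2 ?_) (Real.exp_pos _).le hM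
  · rw [show a ^ 3 * u 0 ^ 2 + v 0 ^ 2 / a ^ 3 = (a ^ 6 * u 0 ^ 2 + v 0 ^ 2) / a ^ 3 by
      field_simp, div_le_iff₀ (by positivity)]
    exact h0
  · have : y / √(a ^ 6 - y ^ 2) ^ 3 ≤ 1 := by
      rw [div_le_one (by positivity)]
      exact hy3.trans (pow_le_pow_left₀ ha.le hs 3)
    linarith

/-- Passing from the Liouville–Green energy to the usual energy at the point where
`a⁶ - b² = a²`. -/
theorem energy_le_of_liouvilleGreen_le {a b p q N : ℝ} (ha : 0 < a) (hb : b ^ 2 ≤ a ^ 6)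
    (h : a * p ^ 2 + (q - b * p / (2 * a ^ 2)) ^ 2 / a ≤ N) :
    a ^ 2 * p ^ 2 + q ^ 2 ≤ 2 * a * N := by
  set w := q - b * p / (2 * a ^ 2) with hw
  have h1 : q ^ 2 ≤ 2 * w ^ 2 + 2 * (b * p / (2 * a ^ 2)) ^ 2 := by
    rw [show q = w + b * p / (2 * a ^ 2) by rw [hw]; ring]
    nlinarith [sq_nonneg (w - b * p / (2 * a ^ 2))]
  have h2 : 2 * (b * p / (2 * a ^ 2)) ^ 2 ≤ a ^ 2 * p ^ 2 := by
    rw [show 2 * (b * p / (2 * a ^ 2)) ^ 2 = b ^ 2 * p ^ 2 / (2 * a ^ 4) by field_simp,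
      div_le_iff₀ (by positivity)]
    have h3 : 0 ≤ a ^ 6 * p ^ 2 := by positivity
    linarith [mul_le_mul_of_nonneg_right hb (sq_nonneg p)]
  have h3 : 2 * a * (a * p ^ 2 + w ^ 2 / a) = 2 * a ^ 2 * p ^ 2 + 2 * w ^ 2 := by
    field_simp
  linarith [mul_le_mul_of_nonneg_left h (by positivity : 0 ≤ 2 * a)]

/-- Bound in the transition region `a⁶ - a² ≤ y² ≤ a⁶`. -/
theorem sq_le_of_energy_le_of_le_turning_point {a b N : ℝ} (ha : 0 < a) {u v : ℝ → ℝ}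
    (hu : ∀ x, HasDerivAt u (v x) x) (hv : ∀ x, HasDerivAt v ((x ^ 2 - a ^ 6) * u x) x)
    (hb : 0 ≤ b) (hb2 : b ^ 2 = a ^ 6 - a ^ 2) (hub : u b ^ 2 ≤ N / a)
    (henergy : a ^ 2 * u b ^ 2 + v b ^ 2 ≤ 2 * a * N) {y : ℝ} (hby : b ≤ y) (hya : y ≤ a ^ 3) :
    u y ^ 2 ≤ 6 * N / a := by
  have hba : b ≤ a ^ 3 := hby.trans hya
  have hderiv : ∀ z ∈ Set.Icc b (a ^ 3), ‖v z‖ ≤ √(2 * a * N) := by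
    rintro z ⟨hbz, hza⟩
    have hz0 : 0 ≤ z := hb.trans hbz
    refine Real.le_sqrt_of_sq_le ?_
    rw [Real.norm_eq_abs, sq_abs]
    have h1 : (a ^ 6 - z ^ 2) * u z ^ 2 + v z ^ 2 ≤ (a ^ 6 - b ^ 2) * u b ^ 2 + v b ^ 2 :=
      antitoneOn_energy hu hv hb hz0 hbz
    have h2 : 0 ≤ (a ^ 6 - z ^ 2) * u z ^ 2 := by
      refine mul_nonneg ?_ (sq_nonneg _)
      linarith [pow_le_pow_left₀ hz0 hza 2]
    rw [hb2, sub_sub_cancel] at h1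
    linarith
  have hdiff : |u y - u b| ≤ √(2 * a * N) * |y - b| :=
    (convex_Icc b (a ^ 3)).norm_image_sub_le_of_norm_hasDerivWithin_le
      (fun z _ => (hu z).hasDerivWithinAt) hderiv ⟨le_rfl, hba⟩ ⟨hby, hya⟩
  have hlen : y - b ≤ 1 / a := by
    have h1 : (a ^ 3 - b) * (a ^ 3 + b) = a ^ 2 := by linear_combination -hb2
    have h2 : (a ^ 3 - b) * a ^ 3 ≤ a ^ 2 := by linarith [mul_nonneg (sub_nonneg.2 hba) hb]
    have h3 : a ^ 3 - b ≤ 1 / a := by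
      rw [show 1 / a = a ^ 2 / a ^ 3 by field_simp, le_div_iff₀ (by positivity)]
      exact h2
    linarith
  have hN : 0 ≤ 2 * a * N := le_trans (by positivity) henergy
  have hsq : (u y - u b) ^ 2 ≤ 2 * N / a := by
    have h1 : (u y - u b) ^ 2 ≤ (√(2 * a * N) * |y - b|) ^ 2 := by
      rw [← sq_abs (u y - u b)]
      exact pow_le_pow_left₀ (abs_nonneg _) hdiff 2
    rw [mul_pow, Real.sq_sqrt hN, sq_abs] at h1
    have h2 : (y - b) ^ 2 ≤ (1 / a) ^ 2 := pow_le_pow_left₀ (by linarith) hlen 2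
    calc (u y - u b) ^ 2 ≤ 2 * a * N * (y - b) ^ 2 := h1
      _ ≤ 2 * a * N * (1 / a) ^ 2 := mul_le_mul_of_nonneg_left h2 hN
      _ = 2 * N / a := by field_simp
  have : 6 * N / a = 2 * (2 * N / a) + 2 * (N / a) := by ring
  linarith [sq_nonneg (u y - 2 * u b)]

/-- Uniform bound for decaying solutions of `u'' = (x² - a⁶) u` on the half line, in terms of the
energy at the origin. -/
theorem sq_le_of_energy_le {a M : ℝ} (ha : 1 ≤ a) {u v : ℝ → ℝ}
    (hu : ∀ x, HasDerivAt u (v x) x) (hv : ∀ x, HasDerivAt v ((x ^ 2 - a ^ 6) * u x) x)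
    (hlim : Tendsto u atTop (𝓝 0)) (h0 : a ^ 6 * u 0 ^ 2 + v 0 ^ 2 ≤ M * a ^ 3)
    {x : ℝ} (hx : 0 ≤ x) : u x ^ 2 ≤ 6 * (M * Real.exp (5 / 4)) / a := by
  have ha0 : 0 < a := by linarith
  have h46 : a ^ 2 ≤ a ^ 6 := pow_le_pow_right₀ ha (by norm_num)
  have hLG := fun y => liouvilleGreen_energy_le_of_energy_le (y := y) ha0 hu hv h0
  set N := M * Real.exp (5 / 4)
  set b := √(a ^ 6 - a ^ 2)
  have hb0 : 0 ≤ b := Real.sqrt_nonneg _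
  have hb2 : b ^ 2 = a ^ 6 - a ^ 2 := Real.sq_sqrt (by linarith)
  have hba6 : b ^ 2 ≤ a ^ 6 := by linarith [sq_nonneg a]
  have hba : b ≤ a ^ 3 := le_of_sq_le_sq (hba6.trans_eq (by ring)) (by positivity)
  have hleft : ∀ y, 0 ≤ y → y ≤ b → u y ^ 2 ≤ N / a := by
    intro y hy hyb
    have hya : a ^ 2 ≤ a ^ 6 - y ^ 2 := by linarith [pow_le_pow_left₀ hy hyb 2]
    have hs : a ≤ √(a ^ 6 - y ^ 2) := Real.le_sqrt_of_sq_le hya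
    rw [le_div_iff₀ ha0]
    have h1 : 0 ≤ (v y - y * u y / (2 * (a ^ 6 - y ^ 2))) ^ 2 / √(a ^ 6 - y ^ 2) := by positivity
    linarith [hLG y hy hya, mul_le_mul_of_nonneg_right hs (sq_nonneg (u y))]
  have henergy : a ^ 2 * u b ^ 2 + v b ^ 2 ≤ 2 * a * N := by
    have hab : a ^ 6 - b ^ 2 = a ^ 2 := by linarith
    have h := hLG b hb0 hab.ge
    rw [hab, Real.sqrt_sq ha0.le] at h
    exact energy_le_of_liouvilleGreen_le ha0 hba6 h
  have hmid : ∀ y, b ≤ y → y ≤ a ^ 3 → u y ^ 2 ≤ 6 * N / a := fun y =>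
    sq_le_of_energy_le_of_le_turning_point ha0 hu hv hb0 hb2 (hleft b hb0 le_rfl) henergy
  rcases le_total x b with h | h
  · have h1 := hleft x hx h
    have h2 : 6 * N / a = 6 * (N / a) := by ring
    linarith [sq_nonneg (u x)]
  rcases le_total x (a ^ 3) with h' | h'
  · exact hmid x h h'
  · have hanti := antitoneOn_sq_of_tendsto_zero (c := a ^ 3) hu hv hlim fun y hy => by
      have hy : a ^ 3 ≤ y := hy
      calc a ^ 6 = (a ^ 3) ^ 2 := by ring
        _ ≤ y ^ 2 := pow_le_pow_left₀ (by positivity) hy 2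
    exact (hanti Set.self_mem_Ici h' h').trans (hmid _ hba le_rfl)

section

open Polynomial

theorem derivative_hermite_succ (n : ℕ) :
    derivative (hermite (n + 1)) = ((n + 1 : ℕ) : ℤ[X]) * hermite n := by
  induction n with
  | zero => simp
  | succ n ih =>
    rw [hermite_succ (n + 1), derivative_sub, derivative_mul, derivative_X, ih,
      derivative_mul, derivative_natCast]
    have := hermite_succ n
    push_cast
    linear_combination -((n : ℤ[X]) + 1) * this

theorem aeval_hermite_zero_sq_le (n : ℕ) :
    ((n : ℝ) + 1) * (aeval (0 : ℝ) (hermite n) ^ 2 / n.factorial) ^ 2 ≤ 1 := by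
  induction n using Nat.twoStepInduction with
  | zero => simp
  | one => simp
  | more n ih _ =>
    have hrec : aeval (0 : ℝ) (hermite (n + 2)) = -((n + 1) * aeval (0 : ℝ) (hermite n)) := by
      rw [hermite_succ, derivative_hermite_succ]
      simp
    set h := aeval (0 : ℝ) (hermite n)
    have hf : (0 : ℝ) < n.factorial := by positivity
    have heq : aeval (0 : ℝ) (hermite (n + 2)) ^ 2 / ((n + 2).factorial : ℝ) =
        (n + 1) / (n + 2) * (h ^ 2 / n.factorial) := by
      rw [hrec, Nat.factorial_succ, Nat.factorial_succ]
      push_cast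
      field_simp
      ring
    rw [heq]
    refine le_trans ?_ ih
    rw [mul_pow, ← mul_assoc]
    refine mul_le_mul_of_nonneg_right ?_ (sq_nonneg _)
    push_cast
    rw [div_pow, ← mul_div_assoc, div_le_iff₀ (by positivity)]
    have hn : (0 : ℝ) ≤ n := n.cast_nonneg
    nlinarith

theorem hermiteP_eq_aeval (n : ℕ) (x : ℝ) : hermiteP n x = aeval x (hermite n) := by
  rw [hermite_eq_deriv_gaussian', hermiteP, iteratedDeriv_eq_iterate]
  simp only [neg_div]
  ring

theorem tendsto_eval_mul_gaussian_atTop (p : ℝ[X]) :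
    Tendsto (fun x => p.eval x * Real.exp (-(x ^ 2) / 2)) atTop (𝓝 0) := by
  have h := (p.tendsto_div_exp_atTop.abs).mul_const (Real.exp (1 / 2))
  rw [abs_zero, zero_mul] at h
  refine squeeze_zero_norm (fun x => ?_) h
  rw [Real.norm_eq_abs, abs_mul, abs_div, Real.abs_exp, Real.abs_exp, div_eq_mul_inv |p.eval x|,
    mul_assoc, ← Real.exp_neg, ← Real.exp_add]
  refine mul_le_mul_of_nonneg_left (Real.exp_le_exp.2 ?_) (abs_nonneg _)
  nlinarith [sq_nonneg (x - 1)]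

/-- Normalising constant of the `(n + 1)`-st Hermite function. -/
def hermiteFunConst (n : ℕ) : ℝ := Real.pi ^ (-(1/4) : ℝ) * (n.factorial : ℝ) ^ (-(1/2) : ℝ)

theorem hermiteFunConst_sq_le (n : ℕ) : hermiteFunConst n ^ 2 ≤ 1 / n.factorial := by
  have hf : (0 : ℝ) < n.factorial := by positivity
  have h1 : Real.pi ^ (-(1/4) : ℝ) ≤ 1 :=
    Real.rpow_le_one_of_one_le_of_nonpos (by linarith [Real.pi_gt_three]) (by norm_num)
  have h2 : ((n.factorial : ℝ) ^ (-(1/2) : ℝ)) ^ 2 = 1 / n.factorial := by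
    rw [← Real.rpow_natCast, ← Real.rpow_mul hf.le]
    norm_num [Real.rpow_neg_one]
  rw [hermiteFunConst, mul_pow, h2]
  exact mul_le_of_le_one_left (by positivity) (pow_le_one₀ (by positivity) h1)

/-- The derivative of the `(n + 1)`-st Hermite function. -/
def hermiteFunDeriv (n : ℕ) (x : ℝ) : ℝ :=
  hermiteFunConst n * Real.exp (-(x ^ 2) / 2) *
    (√2 * aeval (√2 * x) (derivative (hermite n)) - x * aeval (√2 * x) (hermite n))

theorem hermiteFun_succ_eq (n : ℕ) (x : ℝ) : hermiteFun (n + 1) x =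
    hermiteFunConst n * Real.exp (-(x ^ 2) / 2) * aeval (√2 * x) (hermite n) := by
  rw [hermiteFun, hermiteP_eq_aeval, Nat.add_sub_cancel, hermiteFunConst]

theorem hasDerivAt_gaussian (x : ℝ) :
    HasDerivAt (fun y : ℝ => Real.exp (-(y ^ 2) / 2)) (-x * Real.exp (-(x ^ 2) / 2)) x := by
  refine (((hasDerivAt_pow 2 x).neg.div_const 2).exp).congr_deriv ?_
  simp only [Pi.neg_apply]
  push_cast
  ring

theorem hasDerivAt_aeval_sqrt_two_mul (p : ℤ[X]) (x : ℝ) :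
    HasDerivAt (fun y : ℝ => aeval (√2 * y) p) (√2 * aeval (√2 * x) (derivative p)) x := by
  have h : HasDerivAt (fun y : ℝ => √2 * y) √2 x := by
    simpa using (hasDerivAt_id x).const_mul √2
  exact ((p.hasDerivAt_aeval (√2 * x)).comp x h).congr_deriv (mul_comm _ _)

theorem hasDerivAt_hermiteFun (n : ℕ) (x : ℝ) :
    HasDerivAt (hermiteFun (n + 1)) (hermiteFunDeriv n x) x := by
  rw [show hermiteFun (n + 1) = _ from funext (hermiteFun_succ_eq n)]
  refine (((hasDerivAt_gaussian x).const_mul (hermiteFunConst n)).mul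
    (hasDerivAt_aeval_sqrt_two_mul _ x)).congr_deriv ?_
  rw [hermiteFunDeriv]
  ring

theorem derivative_derivative_hermite (n : ℕ) :
    derivative (derivative (hermite n)) = X * derivative (hermite n) - (n : ℤ[X]) * hermite n := by
  have h1 := derivative_hermite_succ n
  rw [hermite_succ, derivative_sub, derivative_mul, derivative_X] at h1
  push_cast at h1
  linear_combination -h1

theorem hasDerivAt_hermiteFunDeriv (n : ℕ) (x : ℝ) :
    HasDerivAt (hermiteFunDeriv n) ((x ^ 2 - (2 * n + 1)) * hermiteFun (n + 1) x) x := by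
  refine (((hasDerivAt_gaussian x).const_mul (hermiteFunConst n)).mul
    (((hasDerivAt_aeval_sqrt_two_mul (derivative (hermite n)) x).const_mul √2).sub
      ((hasDerivAt_id x).mul (hasDerivAt_aeval_sqrt_two_mul (hermite n) x)))).congr_deriv ?_
  rw [hermiteFun_succ_eq, derivative_derivative_hermite]
  simp only [map_sub, map_mul, aeval_X, map_natCast, id, Pi.mul_apply, Pi.sub_apply]
  have h2 : √2 * √2 = (2 : ℝ) := Real.mul_self_sqrt (by norm_num)
  set c := hermiteFunConst n
  set E := Real.exp (-(x ^ 2) / 2)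
  set p := aeval (√2 * x) (hermite n)
  set q := aeval (√2 * x) (derivative (hermite n))
  linear_combination c * E * (√2 * x * q - n * p) * h2

theorem tendsto_hermiteFun_atTop (n : ℕ) : Tendsto (hermiteFun (n + 1)) atTop (𝓝 0) := by
  have h := (tendsto_eval_mul_gaussian_atTop
    (((hermite n).map (Int.castRingHom ℝ)).comp (C √2 * X))).const_mul (hermiteFunConst n)
  rw [mul_zero] at h
  refine h.congr fun x => ?_
  rw [hermiteFun_succ_eq]
  simp [aeval_def, eval_map]
  ring

theorem aeval_neg_hermite (n : ℕ) (x : ℝ) :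
    aeval (-x) (hermite n) = (-1) ^ n * aeval x (hermite n) := by
  induction n using Nat.twoStepInduction with
  | zero => simp
  | one => simp
  | more n ih₀ ih₁ =>
    rw [hermite_succ (n + 1), derivative_hermite_succ]
    simp only [map_sub, map_mul, aeval_X, map_natCast, ih₀, ih₁]
    ring

theorem hermiteFun_abs_sq (n : ℕ) (x : ℝ) :
    hermiteFun (n + 1) |x| ^ 2 = hermiteFun (n + 1) x ^ 2 := by
  rcases abs_choice x with h | h <;> rw [h]
  rw [hermiteFun_succ_eq, hermiteFun_succ_eq, mul_neg, aeval_neg_hermite, neg_sq, mul_pow, mul_pow,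
    mul_pow (_ ^ n), ← pow_mul, mul_comm n 2, pow_mul]
  simp [mul_pow]

theorem hermiteFun_energy_zero_le (n : ℕ) :
    (2 * n + 1) * hermiteFun (n + 1) 0 ^ 2 + hermiteFunDeriv n 0 ^ 2 ≤ 4 * √(2 * n + 1) := by
  have hn : (0 : ℝ) ≤ n := n.cast_nonneg
  have hB : ∀ m : ℕ, aeval (0 : ℝ) (hermite m) ^ 2 / m.factorial ≤ 1 / √(m + 1) := by
    intro m
    have hm : (0 : ℝ) < √(m + 1) := by positivity
    rw [le_div_iff₀ hm]
    refine le_of_sq_le_sq ?_ zero_le_one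
    rw [mul_pow, Real.sq_sqrt (by positivity), mul_comm]
    simpa using aeval_hermite_zero_sq_le m
  have hpos : hermiteFun (n + 1) 0 ^ 2 ≤ 1 / √(n + 1) := by
    rw [hermiteFun_succ_eq]
    refine le_trans ?_ (hB n)
    simp only [mul_zero, mul_pow]
    norm_num
    rw [div_eq_inv_mul]
    have := hermiteFunConst_sq_le n
    rw [one_div] at this
    gcongr
  have hvel : hermiteFunDeriv n 0 ^ 2 ≤ 2 * √(2 * n + 1) := by
    cases n with
    | zero => simp [hermiteFunDeriv]
    | succ m =>
      have hc := hermiteFunConst_sq_le (m + 1)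
      have h1 : hermiteFunDeriv (m + 1) 0 ^ 2 =
          hermiteFunConst (m + 1) ^ 2 * (2 * (m + 1) ^ 2 * aeval (0 : ℝ) (hermite m) ^ 2) := by
        rw [hermiteFunDeriv, derivative_hermite_succ]
        simp only [map_mul, map_natCast, mul_zero, zero_mul, sub_zero, mul_pow,
          Real.sq_sqrt zero_le_two, ne_eq, OfNat.ofNat_ne_zero, not_false_eq_true, zero_pow,
          neg_zero, zero_div, Real.exp_zero, one_pow]
        push_cast
        ring
      have hm : (0 : ℝ) < m + 1 := by positivity
      calc hermiteFunDeriv (m + 1) 0 ^ 2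
          ≤ 1 / (m + 1).factorial * (2 * (m + 1) ^ 2 * aeval (0 : ℝ) (hermite m) ^ 2) := by
            rw [h1]
            gcongr
        _ = 2 * (m + 1) * (aeval (0 : ℝ) (hermite m) ^ 2 / m.factorial) := by
            rw [Nat.factorial_succ]
            push_cast
            field_simp
        _ ≤ 2 * (m + 1) * (1 / √(m + 1)) := by
            exact mul_le_mul_of_nonneg_left (hB m) (by positivity)
        _ = 2 * √(m + 1) := by
            rw [mul_assoc, mul_one_div, Real.div_sqrt]
        _ ≤ 2 * √(2 * (m + 1 : ℕ) + 1) := by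
            gcongr
            push_cast
            linarith
  have h1 : (2 * n + 1) * hermiteFun (n + 1) 0 ^ 2 ≤ 2 * √(2 * n + 1) := by
    calc (2 * n + 1) * hermiteFun (n + 1) 0 ^ 2 ≤ (2 * (n + 1)) * (1 / √(n + 1)) := by
          gcongr
          linarith
      _ = 2 * √(n + 1) := by rw [mul_assoc, mul_one_div, Real.div_sqrt]
      _ ≤ 2 * √(2 * n + 1) := by
          gcongr
          linarith
  linarith

end

/-- There is a constant `C > 0` such that `sup_{x ∈ ℝ} |e_k(x)| ≤ C k^{−1/12}` for all
`k ≥ 1`; i.e. `sup_x |e_k(x)| = O(k^{−1/12})`. -/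
theorem hermiteFun_sup_bound :
    ∃ C : ℝ, 0 < C ∧ ∀ k : ℕ, 1 ≤ k → ∀ x : ℝ,
      |hermiteFun k x| ≤ C * (k : ℝ) ^ (-(1/12) : ℝ) := by
  set N := 6 * (4 * Real.exp (5 / 4)) with hN
  have hN0 : 0 < N := by positivity
  refine ⟨√N, Real.sqrt_pos.2 hN0, fun k hk x => ?_⟩
  obtain ⟨n, rfl⟩ := Nat.exists_eq_add_of_le' hk
  set a : ℝ := (2 * n + 1 : ℝ) ^ (1 / 6 : ℝ) with ha
  have hn : (0 : ℝ) ≤ n := n.cast_nonneg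
  have ha1 : 1 ≤ a := Real.one_le_rpow (by linarith) (by norm_num)
  have ha6 : a ^ 6 = 2 * n + 1 := by
    rw [ha, ← Real.rpow_natCast, ← Real.rpow_mul (by positivity)]
    norm_num
  have ha3 : a ^ 3 = √(2 * n + 1) := by
    rw [← ha6, show a ^ 6 = (a ^ 3) ^ 2 by ring, Real.sqrt_sq (by positivity)]
  have hsq : hermiteFun (n + 1) x ^ 2 ≤ N / a := by
    rw [← hermiteFun_abs_sq]
    exact sq_le_of_energy_le ha1 (hasDerivAt_hermiteFun n)
      (fun y => ha6 ▸ hasDerivAt_hermiteFunDeriv n y) (tendsto_hermiteFun_atTop n)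
      (by rw [ha6, ha3]; exact hermiteFun_energy_zero_le n) (abs_nonneg x)
  have hk0 : (0 : ℝ) < ((n + 1 : ℕ) : ℝ) := by positivity
  have hle : N / a ≤ (√N * ((n + 1 : ℕ) : ℝ) ^ (-(1/12) : ℝ)) ^ 2 := by
    rw [mul_pow, Real.sq_sqrt hN0.le, ← Real.rpow_natCast, ← Real.rpow_mul hk0.le, div_eq_mul_inv,
      ha, ← Real.rpow_neg (by positivity)]
    refine mul_le_mul_of_nonneg_left ?_ hN0.le
    rw [show -(1 / 12 : ℝ) * (2 : ℕ) = -(1 / 6) by norm_num]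
    refine Real.rpow_le_rpow_of_nonpos hk0 ?_ (by norm_num)
    push_cast
    linarith
  exact abs_le_of_sq_le_sq (hsq.trans hle) (by positivity)

end
end
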